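/- arXiv:1502.02310 — 3 statements merged into one kernel-verified Lean document; each statement's English description precedes it below -/
import Mathlib

section
/- Let Σ be a finite alphabet and φ : Σ* → Σ* a nonerasing morphism. If b ∈ Σ is a letter of finite order k, then φ(b) contains at least one letter of order k. Moreover, either b never occurs in φ^n(b) for any n ≥ 1 (b is preperiodic), or, for every n ≥ 0, the word φ^n(b) contains exactly one occurrence of a letter of order k, and, denoting this letter by c_n (with c_0 = b), the sequence (c_n)_{n ≥ 0} is periodic: there exists d ≥ 1 with c_{n+d} = c_n for all n ≥ 0 (b is periodic). -/
open Asymptotics Filter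

/-- Apply a morphism (given by its values on letters) to a finite word. -/
def substWord {A : Type*} (φ : A → List A) : List A → List A
  | [] => []
  | a :: w => φ a ++ substWord φ w

/-- The `n`-th iterate of a morphism applied to a word. -/
def iterWord {A : Type*} (φ : A → List A) (n : ℕ) (w : List A) : List A :=
  (substWord φ)^[n] w

/-- The letter `b` has finite order `k`: `k ≥ 1` and `|φ^n(b)| = Θ(n^(k−1))`. -/
def HasOrder {A : Type*} (φ : A → List A) (b : A) (k : ℕ) : Prop :=
  1 ≤ k ∧
    (fun n => ((iterWord φ n [b]).length : ℝ)) =Θ[atTop] (fun n => (n : ℝ) ^ (k - 1))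

/-- A sequence `f` of naturals grows like `n ^ d`, with a single constant valid for all indices. -/
def PolyGrowth (f : ℕ → ℕ) (d : ℕ) : Prop :=
  ∃ C : ℕ, ∀ n, f n ≤ C * (n + 1) ^ d ∧ (n + 1) ^ d ≤ C * f n

theorem le_of_forall_pow_le_mul_pow {C d e : ℕ}
    (h : ∀ n : ℕ, (n + 1) ^ d ≤ C * (n + 1) ^ e) : d ≤ e := by
  by_contra! hlt
  have h1 := h C
  have h2 : (C + 1) ^ (e + 1) ≤ (C + 1) ^ d := Nat.pow_le_pow_right (by omega) hlt
  have h3 : 0 < (C + 1) ^ e := by positivity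
  rw [pow_succ] at h2
  nlinarith

theorem PolyGrowth.unique {f : ℕ → ℕ} {d e : ℕ} (hd : PolyGrowth f d) (he : PolyGrowth f e) :
    d = e := by
  have key : ∀ {d e : ℕ}, PolyGrowth f d → PolyGrowth f e → d ≤ e := by
    rintro d e ⟨C, hC⟩ ⟨D, hD⟩
    refine le_of_forall_pow_le_mul_pow (C := C * D) fun n => (hC n).2.trans ?_
    rw [mul_assoc]
    exact Nat.mul_le_mul_left C (hD n).1
  exact le_antisymm (key hd he) (key he hd)

/-- Adding a sequence of smaller or equal growth does not change the growth. -/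
theorem PolyGrowth.add {f g : ℕ → ℕ} {d e : ℕ} (hf : PolyGrowth f d) (hg : PolyGrowth g e)
    (hed : e ≤ d) : PolyGrowth (fun n => f n + g n) d := by
  obtain ⟨C, hC⟩ := hf
  obtain ⟨D, hD⟩ := hg
  refine ⟨C + D, fun n => ?_⟩
  have h1 : (n + 1) ^ e ≤ (n + 1) ^ d := Nat.pow_le_pow_right (by omega) hed
  have h2 := Nat.mul_le_mul_left D h1
  have h3 := hC n
  have h4 := hD n
  constructor
  · nlinarith
  · nlinarith [Nat.zero_le (C * g n), Nat.zero_le (D * f n), Nat.zero_le (D * g n)]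

theorem PolyGrowth.of_shift {f : ℕ → ℕ} {d : ℕ} (hmono : Monotone f) (hpos : ∀ n, 1 ≤ f n)
    (h : PolyGrowth (fun n => f (n + 1)) d) : PolyGrowth f d := by
  obtain ⟨C, hC⟩ := h
  refine ⟨2 ^ d * C + 1, fun n => ⟨?_, ?_⟩⟩
  · refine ((hmono (Nat.le_succ n)).trans (hC n).1).trans (Nat.mul_le_mul_right _ ?_)
    nlinarith [Nat.one_le_two_pow (n := d)]
  · cases n with
    | zero => simpa using Nat.mul_le_mul (Nat.le_add_left 1 (2 ^ d * C)) (hpos 0)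
    | succ n =>
      calc (n + 1 + 1) ^ d ≤ (2 * (n + 1)) ^ d := Nat.pow_le_pow_left (by omega) d
        _ = 2 ^ d * (n + 1) ^ d := mul_pow _ _ _
        _ ≤ 2 ^ d * (C * f (n + 1)) := Nat.mul_le_mul_left _ (hC n).2
        _ = 2 ^ d * C * f (n + 1) := (mul_assoc _ _ _).symm
        _ ≤ (2 ^ d * C + 1) * f (n + 1) := Nat.mul_le_mul_right _ (Nat.le_succ _)

theorem add_pow_succ_le (a p d : ℕ) :
    (a + p) ^ (d + 1) ≤ a ^ (d + 1) + p * (d + 1) * (a + p) ^ d := by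
  induction d with
  | zero => simp
  | succ d ih =>
    have h1 : a ^ (d + 1) ≤ (a + p) ^ (d + 1) := Nat.pow_le_pow_left (by omega) _
    calc (a + p) ^ (d + 1 + 1) = (a + p) ^ (d + 1) * (a + p) := pow_succ _ _
      _ ≤ (a ^ (d + 1) + p * (d + 1) * (a + p) ^ d) * (a + p) := Nat.mul_le_mul_right _ ih
      _ = a ^ (d + 1 + 1) + p * a ^ (d + 1) + p * (d + 1) * (a + p) ^ (d + 1) := by ring
      _ ≤ a ^ (d + 1 + 1) + p * (a + p) ^ (d + 1) + p * (d + 1) * (a + p) ^ (d + 1) := by gcongr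
      _ = _ := by ring

/-- A discrete integration bound from below. -/
theorem exists_pow_succ_le_of_add_le {f g : ℕ → ℕ} {C d p : ℕ} (hp : 1 ≤ p)
    (hpos : ∀ n, 1 ≤ f n) (hfg : ∀ n, f n + g n ≤ f (n + p))
    (hg : ∀ n, (n + 1) ^ d ≤ C * g n) : ∃ M, ∀ n, (n + 1) ^ (d + 1) ≤ M * f n := by
  refine ⟨p * (d + 1) * (p + 1) ^ d * C + p ^ (d + 1), fun n => ?_⟩
  set M := p * (d + 1) * (p + 1) ^ d * C + p ^ (d + 1) with hM
  induction n using Nat.strong_induction_on with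
  | _ n ih =>
    rcases lt_or_ge n p with hn | hn
    · calc (n + 1) ^ (d + 1) ≤ p ^ (d + 1) := Nat.pow_le_pow_left hn _
        _ ≤ M * 1 := by omega
        _ ≤ M * f n := Nat.mul_le_mul_left _ (hpos n)
    · obtain ⟨m, rfl⟩ := Nat.exists_eq_add_of_le' hn
      have h1 : (m + 1 + p) ^ d ≤ (p + 1) ^ d * (m + 1) ^ d := by
        rw [← mul_pow]
        exact Nat.pow_le_pow_left (by nlinarith) d
      calc (m + p + 1) ^ (d + 1) = (m + 1 + p) ^ (d + 1) := by ring
        _ ≤ (m + 1) ^ (d + 1) + p * (d + 1) * (m + 1 + p) ^ d := add_pow_succ_le _ _ _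
        _ ≤ M * f m + p * (d + 1) * ((p + 1) ^ d * (C * g m)) := by
          gcongr
          · exact ih m (by omega)
          · exact h1.trans (Nat.mul_le_mul_left _ (hg m))
        _ = M * f m + p * (d + 1) * (p + 1) ^ d * C * g m := by ring
        _ ≤ M * f m + M * g m := by gcongr; omega
        _ = M * (f m + g m) := by ring
        _ ≤ M * f (m + p) := Nat.mul_le_mul_left _ (hfg m)

theorem PolyGrowth.of_add_eq {f g : ℕ → ℕ} {d p : ℕ} (hp : 1 ≤ p) (hmono : Monotone f)
    (hpos : ∀ n, 1 ≤ f n) (hfg : ∀ n, f (n + p) = f n + g n) (hg : PolyGrowth g d) :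
    PolyGrowth f (d + 1) := by
  obtain ⟨C, hC⟩ := hg
  obtain ⟨M, hM⟩ := exists_pow_succ_le_of_add_le hp hpos (fun n => (hfg n).ge) fun n => (hC n).2
  have upper : ∀ n, f n ≤ f p + n * (C * (n + 1) ^ d) := by
    intro n
    induction n using Nat.strong_induction_on with
    | _ n ih =>
      rcases lt_or_ge n p with hn | hn
      · exact (hmono hn.le).trans (Nat.le_add_right _ _)
      · obtain ⟨m, rfl⟩ := Nat.exists_eq_add_of_le' hn
        have h1 : (m + 1) ^ d ≤ (m + p + 1) ^ d := Nat.pow_le_pow_left (by omega) d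
        calc f (m + p) = f m + g m := hfg m
          _ ≤ f p + m * (C * (m + 1) ^ d) + C * (m + 1) ^ d :=
            Nat.add_le_add (ih m (by omega)) (hC m).1
          _ = f p + (m + 1) * (C * (m + 1) ^ d) := by ring
          _ ≤ f p + (m + p) * (C * (m + p + 1) ^ d) := by gcongr
  refine ⟨f p + C + M, fun n => ⟨?_, ?_⟩⟩
  · have h1 : 1 ≤ (n + 1) ^ (d + 1) := Nat.one_le_pow _ _ (by omega)
    calc f n ≤ f p + n * (C * (n + 1) ^ d) := upper n
      _ ≤ f p * (n + 1) ^ (d + 1) + (n + 1) * (C * (n + 1) ^ d) := by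
        gcongr
        · exact Nat.le_mul_of_pos_right _ h1
        · omega
      _ = (f p + C) * (n + 1) ^ (d + 1) := by ring
      _ ≤ _ := Nat.mul_le_mul_right _ (Nat.le_add_right _ _)
  · exact (hM n).trans (Nat.mul_le_mul_right _ (by omega))

theorem PolyGrowth.of_periodic {f : ℕ → ℕ} {p : ℕ} (hp : 1 ≤ p) (hmono : Monotone f)
    (hpos : ∀ n, 1 ≤ f n) (hf : ∀ n, f (n + p) = f n) : PolyGrowth f 0 := by
  have upper : ∀ n, f n ≤ f p := by
    intro n
    induction n using Nat.strong_induction_on with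
    | _ n ih =>
      rcases lt_or_ge n p with hn | hn
      · exact hmono hn.le
      · obtain ⟨m, rfl⟩ := Nat.exists_eq_add_of_le' hn
        exact (hf m).trans_le (ih m (by omega))
  refine ⟨f p, fun n => ⟨by simpa using upper n, ?_⟩⟩
  simpa using Nat.mul_le_mul (hpos p) (hpos n)

theorem isTheta_natCast_pow_iff_polyGrowth {f : ℕ → ℕ} {d : ℕ} (hpos : ∀ n, 1 ≤ f n) :
    ((fun n => (f n : ℝ)) =Θ[atTop] fun n => (n : ℝ) ^ d) ↔ PolyGrowth f d := by
  have hshift : (fun n : ℕ => (n : ℝ) ^ d) =Θ[atTop] fun n => ((n + 1 : ℕ) : ℝ) ^ d := by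
    refine IsTheta.pow ⟨?_, ?_⟩ d
    · refine IsBigO.of_bound 1 (Eventually.of_forall fun n => ?_)
      simp only [Real.norm_natCast, one_mul]
      exact_mod_cast n.le_succ
    · refine IsBigO.of_bound 2 ((eventually_ge_atTop 1).mono fun n hn => ?_)
      simp only [Real.norm_natCast]
      exact_mod_cast (by omega : n + 1 ≤ 2 * n)
  have hne : ∀ n : ℕ, ((n + 1 : ℕ) : ℝ) ^ d ≠ 0 := fun n => by positivity
  have hfne : ∀ n, (f n : ℝ) ≠ 0 := fun n => by exact_mod_cast Nat.one_le_iff_ne_zero.1 (hpos n)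
  rw [hshift.isTheta_congr_right, IsTheta, isBigO_nat_atTop_iff fun n h => absurd h (hne n),
    isBigO_nat_atTop_iff fun n h => absurd h (hfne n)]
  simp only [norm_pow, Real.norm_natCast]
  constructor
  · rintro ⟨⟨C, hC⟩, D, hD⟩
    obtain ⟨K, hK⟩ := exists_nat_ge (max C D)
    refine ⟨K, fun n => ⟨?_, ?_⟩⟩
    · exact_mod_cast (hC n).trans
        (mul_le_mul_of_nonneg_right ((le_max_left _ _).trans hK) (by positivity))
    · exact_mod_cast (hD n).trans
        (mul_le_mul_of_nonneg_right ((le_max_right _ _).trans hK) (by positivity))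
  · rintro ⟨C, hC⟩
    exact ⟨⟨C, fun n => by exact_mod_cast (hC n).1⟩, C, fun n => by exact_mod_cast (hC n).2⟩

section Words

variable {A : Type*} (φ : A → List A)

theorem substWord_append (u v : List A) :
    substWord φ (u ++ v) = substWord φ u ++ substWord φ v := by
  induction u with
  | nil => rfl
  | cons a u ih => simp [substWord, ih]

theorem iterWord_append (n : ℕ) (u v : List A) :
    iterWord φ n (u ++ v) = iterWord φ n u ++ iterWord φ n v := by
  induction n generalizing u v with
  | zero => rfl
  | succ n ih =>
    simp only [iterWord, Function.iterate_succ, Function.comp_apply, substWord_append] at ih ⊢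
    exact ih _ _

theorem iterWord_add (m n : ℕ) (w : List A) :
    iterWord φ (m + n) w = iterWord φ m (iterWord φ n w) :=
  Function.iterate_add_apply _ m n w

theorem iterWord_one_singleton (b : A) : iterWord φ 1 [b] = φ b := by
  simp [iterWord, substWord]

theorem iterWord_succ (n : ℕ) (w : List A) :
    iterWord φ (n + 1) w = substWord φ (iterWord φ n w) :=
  Function.iterate_succ_apply' _ n w

theorem iterWord_succ_singleton (n : ℕ) (b : A) :
    iterWord φ (n + 1) [b] = iterWord φ n (φ b) := by
  rw [iterWord_add, iterWord_one_singleton]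

theorem iterWord_nil (n : ℕ) : iterWord φ n [] = [] := by
  induction n with
  | zero => rfl
  | succ n ih => rw [iterWord_succ, ih]; rfl

theorem length_iterWord (n : ℕ) (w : List A) :
    (iterWord φ n w).length = (w.map fun a => (iterWord φ n [a]).length).sum := by
  induction w with
  | nil => simp [iterWord_nil]
  | cons a w ih =>
    rw [← List.singleton_append, iterWord_append, List.length_append, ih]
    simp

theorem mem_iterWord_trans {a b c : A} {m n : ℕ} (hb : b ∈ iterWord φ n [a])
    (hc : c ∈ iterWord φ m [b]) : c ∈ iterWord φ (m + n) [a] := by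
  obtain ⟨u, v, h⟩ := List.append_of_mem hb
  rw [iterWord_add, h, ← List.singleton_append, iterWord_append, iterWord_append]
  simp [hc]

theorem mem_iterWord_mul {b : A} {p : ℕ} (h : b ∈ iterWord φ p [b]) (m : ℕ) :
    b ∈ iterWord φ (p * m) [b] := by
  induction m with
  | zero => simp [iterWord]
  | succ m ih => exact mem_iterWord_trans φ h ih

theorem length_le_length_substWord (hφ : ∀ b : A, φ b ≠ []) (w : List A) :
    w.length ≤ (substWord φ w).length := by
  induction w with
  | nil => simp
  | cons a w ih =>
    have := List.length_pos_iff.2 (hφ a)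
    simp only [substWord, List.length_append, List.length_cons]
    omega

theorem monotone_length_iterWord (hφ : ∀ b : A, φ b ≠ []) (w : List A) :
    Monotone fun n => (iterWord φ n w).length :=
  monotone_nat_of_le_succ fun n => by
    simpa only [iterWord_succ] using length_le_length_substWord φ hφ (iterWord φ n w)

theorem one_le_length_iterWord (hφ : ∀ b : A, φ b ≠ []) (b : A) (n : ℕ) :
    1 ≤ (iterWord φ n [b]).length :=
  monotone_length_iterWord φ hφ [b] n.zero_le

theorem hasOrder_iff_polyGrowth (hφ : ∀ b : A, φ b ≠ []) (b : A) (k : ℕ) :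
    HasOrder φ b k ↔ 1 ≤ k ∧ PolyGrowth (fun n => (iterWord φ n [b]).length) (k - 1) :=
  and_congr_right fun _ =>
    isTheta_natCast_pow_iff_polyGrowth (one_le_length_iterWord φ hφ b)

theorem length_iterWord_singleton_le {c : A} {w : List A} (hc : c ∈ w) (n : ℕ) :
    (iterWord φ n [c]).length ≤ (iterWord φ n w).length := by
  rw [length_iterWord φ n w]
  exact List.single_le_sum (by simp) _ (List.mem_map_of_mem hc)

theorem length_iterWord_le_of_mem {b c : A} {m : ℕ} (hc : c ∈ iterWord φ m [b]) (n : ℕ) :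
    (iterWord φ n [c]).length ≤ (iterWord φ (n + m) [b]).length := by
  rw [iterWord_add]
  exact length_iterWord_singleton_le φ hc n

/-- Among the letters of a nonempty word, one grows as fast as the whole word. -/
theorem exists_mem_polyGrowth_iterWord {w : List A} (hw : w ≠ [])
    (h : ∀ c ∈ w, ∃ d, PolyGrowth (fun n => (iterWord φ n [c]).length) d) :
    ∃ c ∈ w, ∃ d, PolyGrowth (fun n => (iterWord φ n [c]).length) d ∧
      PolyGrowth (fun n => (iterWord φ n w).length) d := by
  induction w with
  | nil => exact absurd rfl hw
  | cons a w ih =>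
    obtain ⟨d, hd⟩ := h a (by simp)
    rcases eq_or_ne w [] with rfl | hw'
    · exact ⟨a, by simp, d, hd, hd⟩
    obtain ⟨c, hc, e, hce, hwe⟩ := ih hw' fun c hc => h c (by simp [hc])
    have hsum : (fun n => (iterWord φ n (a :: w)).length) =
        fun n => (iterWord φ n [a]).length + (iterWord φ n w).length := by
      funext n
      rw [← List.singleton_append, iterWord_append, List.length_append]
    rw [hsum]
    rcases le_total e d with hed | hde
    · exact ⟨a, by simp, d, hd, hd.add hwe hed⟩
    · refine ⟨c, by simp [hc], e, hce, ?_⟩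
      simpa only [add_comm] using hwe.add hd hde

variable {φ}

theorem length_iterWord_add_of_eq {b : A} {u v : List A} {p : ℕ}
    (huv : iterWord φ p [b] = u ++ b :: v) (n : ℕ) :
    (iterWord φ (n + p) [b]).length =
      (iterWord φ n [b]).length + (iterWord φ n (u ++ v)).length := by
  rw [iterWord_add φ n p, huv, ← List.singleton_append, iterWord_append, iterWord_append,
    iterWord_append]
  simp only [List.length_append]
  ring

/-- If `b` recurs in `φ ^ p (b)` next to a letter that leads back to `b`, then the growth of `b`
exceeds every polynomial. -/
theorem not_mem_iterWord_of_polynomial_bound (hφ : ∀ b : A, φ b ≠ []) {b c : A} {u v : List A}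
    {p q C d : ℕ} (hp : 1 ≤ p) (hC : ∀ n, (iterWord φ n [b]).length ≤ C * (n + 1) ^ d)
    (huv : iterWord φ p [b] = u ++ b :: v) (hc : c ∈ u ++ v) : b ∉ iterWord φ q [c] := by
  intro hq
  have hmono := monotone_length_iterWord φ hφ [b]
  have hdouble : ∀ n, 2 * (iterWord φ n [b]).length ≤ (iterWord φ (n + (p + q)) [b]).length := by
    intro n
    have h1 : (iterWord φ n [b]).length ≤ (iterWord φ (n + q) [b]).length := hmono (by omega)
    have h2 := length_iterWord_le_of_mem φ hq n
    have h3 := length_iterWord_singleton_le φ hc (n + q)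
    rw [show n + (p + q) = n + q + p by ring, length_iterWord_add_of_eq huv]
    omega
  have hexp : ∀ m, 2 ^ m ≤ (iterWord φ (m * (p + q)) [b]).length := by
    intro m
    induction m with
    | zero => simp [iterWord]
    | succ m ih =>
      rw [pow_succ, Nat.succ_mul]
      have := hdouble (m * (p + q))
      omega
  have hbound : ∀ m : ℕ, 2 ^ m ≤ C * (p + q) ^ d * (m + 1) ^ d := by
    intro m
    calc 2 ^ m ≤ C * (m * (p + q) + 1) ^ d := (hexp m).trans (hC _)
      _ ≤ C * ((p + q) * (m + 1)) ^ d := by gcongr; nlinarith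
      _ = _ := by rw [mul_pow]; ring
  have hlim : Tendsto (fun m : ℕ => ((m + 1 : ℕ) : ℝ) ^ d / (2 : ℝ) ^ (m + 1)) atTop (nhds 0) :=
    (tendsto_pow_const_div_const_pow_of_one_lt d (by norm_num : (1 : ℝ) < 2)).comp
      (tendsto_add_atTop_nat 1)
  have hlim' := hlim.const_mul (2 * (C * (p + q) ^ d : ℕ) : ℝ)
  rw [mul_zero] at hlim'
  obtain ⟨m, hm⟩ := (hlim'.eventually (gt_mem_nhds one_pos)).exists
  have h1 : (2 : ℝ) ^ m ≤ (C * (p + q) ^ d : ℕ) * ((m + 1 : ℕ) : ℝ) ^ d := by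
    exact_mod_cast hbound m
  rw [← mul_div_assoc, div_lt_one (by positivity), pow_succ] at hm
  linarith

/-- Every letter of polynomially bounded growth has a growth exponent. -/
theorem exists_polyGrowth_of_polynomial_bound [Finite A] (hφ : ∀ b : A, φ b ≠ []) (b : A)
    (hb : ∃ C d, ∀ n, (iterWord φ n [b]).length ≤ C * (n + 1) ^ d) :
    ∃ d, PolyGrowth (fun n => (iterWord φ n [b]).length) d := by
  let below : A → A → Prop := fun c b =>
    (∃ n, c ∈ iterWord φ n [b]) ∧ ∀ n, b ∉ iterWord φ n [c]
  have : IsTrans A below := ⟨by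
    rintro x y z ⟨⟨m, hm⟩, -⟩ ⟨⟨n, hn⟩, h⟩
    exact ⟨⟨m + n, mem_iterWord_trans φ hn hm⟩, fun q hq => h _ (mem_iterWord_trans φ hm hq)⟩⟩
  have : Std.Irrefl below := ⟨fun x hx => hx.2 0 (by simp [iterWord])⟩
  have hwf : WellFounded below := Finite.wellFounded_of_trans_of_irrefl below
  induction b using hwf.induction with
  | _ b ih =>
    obtain ⟨C, d, hC⟩ := hb
    have hmono := monotone_length_iterWord φ hφ [b]
    have hpos := one_le_length_iterWord φ hφ b
    have hlow : ∀ c m, c ∈ iterWord φ m [b] → (∀ q, b ∉ iterWord φ q [c]) →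
        ∃ d, PolyGrowth (fun n => (iterWord φ n [c]).length) d := by
      intro c m hc hcb
      refine ih c ⟨⟨m, hc⟩, hcb⟩ ⟨C * (m + 1) ^ d, d, fun n => ?_⟩
      calc (iterWord φ n [c]).length ≤ C * (n + m + 1) ^ d :=
            (length_iterWord_le_of_mem φ hc n).trans (hC _)
        _ ≤ C * ((m + 1) * (n + 1)) ^ d := by gcongr; nlinarith
        _ = _ := by rw [mul_pow]; ring
    by_cases hrec : ∃ p, 1 ≤ p ∧ b ∈ iterWord φ p [b]
    · obtain ⟨p, hp, hbp⟩ := hrec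
      obtain ⟨u, v, huv⟩ := List.append_of_mem hbp
      have hstep := length_iterWord_add_of_eq huv
      by_cases hw : u ++ v = []
      · refine ⟨0, PolyGrowth.of_periodic hp hmono hpos fun n => ?_⟩
        simp [hstep n, hw, iterWord_nil]
      · obtain ⟨c, -, e, -, he⟩ := exists_mem_polyGrowth_iterWord φ hw fun c hc =>
          hlow c p (by rw [huv]; simp only [List.mem_append, List.mem_cons] at hc ⊢; tauto)
            fun q => not_mem_iterWord_of_polynomial_bound hφ hp hC huv hc
        exact ⟨e + 1, PolyGrowth.of_add_eq hp hmono hpos hstep he⟩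
    · obtain ⟨c, -, e, -, he⟩ := exists_mem_polyGrowth_iterWord φ (hφ b) fun c hc => by
        rw [← iterWord_one_singleton φ b] at hc
        exact hlow c 1 hc fun q hq => hrec ⟨q + 1, by omega, mem_iterWord_trans φ hc hq⟩
      refine ⟨e, PolyGrowth.of_shift hmono hpos ?_⟩
      simpa only [iterWord_succ_singleton] using he

theorem HasOrder.exists_mem [Finite A] (hφ : ∀ b : A, φ b ≠ []) {b : A} {k : ℕ}
    (hb : HasOrder φ b k) : ∃ c ∈ φ b, HasOrder φ c k := by
  obtain ⟨hk, hgrowth⟩ := (hasOrder_iff_polyGrowth φ hφ b k).1 hb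
  obtain ⟨C, hC⟩ := id hgrowth
  obtain ⟨c, hc, e, hce, he⟩ := exists_mem_polyGrowth_iterWord φ (hφ b) fun c hc => by
    refine exists_polyGrowth_of_polynomial_bound hφ c ⟨C * 2 ^ (k - 1), k - 1, fun n => ?_⟩
    rw [← iterWord_one_singleton φ b] at hc
    calc (iterWord φ n [c]).length ≤ C * (n + 1 + 1) ^ (k - 1) :=
          (length_iterWord_le_of_mem φ hc n).trans (hC _).1
      _ ≤ C * (2 * (n + 1)) ^ (k - 1) := by gcongr; omega
      _ = _ := by rw [mul_pow]; ring
  have hshift : PolyGrowth (fun n => (iterWord φ n [b]).length) e := by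
    refine PolyGrowth.of_shift (monotone_length_iterWord φ hφ [b])
      (one_le_length_iterWord φ hφ b) ?_
    simpa only [iterWord_succ_singleton] using he
  rw [hshift.unique hgrowth] at hce
  exact ⟨c, hc, (hasOrder_iff_polyGrowth φ hφ c k).2 ⟨hk, hce⟩⟩

/-- The companions of a recurrent letter have a different order. -/
theorem HasOrder.not_hasOrder_of_iterWord_eq (hφ : ∀ b : A, φ b ≠ []) {b c : A} {k p : ℕ}
    {u v : List A} (hb : HasOrder φ b k) (hp : 1 ≤ p) (huv : iterWord φ p [b] = u ++ b :: v)
    (hc : c ∈ u ++ v) : ¬ HasOrder φ c k := by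
  intro hck
  obtain ⟨-, C, hC⟩ := (hasOrder_iff_polyGrowth φ hφ b k).1 hb
  obtain ⟨-, D, hD⟩ := (hasOrder_iff_polyGrowth φ hφ c k).1 hck
  have hstep : ∀ n, (iterWord φ n [b]).length + (iterWord φ n [c]).length ≤
      (iterWord φ (n + p) [b]).length := by
    intro n
    have h := length_iterWord_singleton_le φ hc n
    rw [length_iterWord_add_of_eq huv]
    omega
  obtain ⟨M, hM⟩ := exists_pow_succ_le_of_add_le hp (one_le_length_iterWord φ hφ b) hstep
    fun n => (hD n).2
  have := le_of_forall_pow_le_mul_pow (C := M * C) fun n =>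
    (hM n).trans ((Nat.mul_le_mul_left M (hC n).1).trans_eq (mul_assoc _ _ _).symm)
  omega

open Classical in
theorem countP_le_countP_substWord {P : A → Prop} (hP : ∀ a, P a → ∃ c ∈ φ a, P c)
    (w : List A) : w.countP P ≤ (substWord φ w).countP P := by
  induction w with
  | nil => simp
  | cons a w ih =>
    rw [substWord, List.countP_append, List.countP_cons]
    by_cases ha : P a
    · obtain ⟨c, hc, hPc⟩ := hP a ha
      have : 0 < (φ a).countP P := List.countP_pos_iff.2 ⟨c, hc, by simpa using hPc⟩
      simp only [ha, decide_true, if_true]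
      omega
    · simp only [ha, decide_false]
      simp
      omega

open Classical in
theorem HasOrder.countP_iterWord [Finite A] (hφ : ∀ b : A, φ b ≠ []) {b : A} {k p : ℕ}
    (hb : HasOrder φ b k) (hp : 1 ≤ p) (hbp : b ∈ iterWord φ p [b]) (n : ℕ) :
    (iterWord φ n [b]).countP (fun c => HasOrder φ c k) = 1 := by
  have hmono : Monotone fun n => (iterWord φ n [b]).countP (fun c => HasOrder φ c k) :=
    monotone_nat_of_le_succ fun n => by
      simpa only [iterWord_succ] using
        countP_le_countP_substWord (fun a ha => HasOrder.exists_mem hφ ha) (iterWord φ n [b])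
  have hzero : (iterWord φ 0 [b]).countP (fun c => HasOrder φ c k) = 1 := by
    simp [iterWord, hb]
  have hlast : (iterWord φ (p * (n + 1)) [b]).countP (fun c => HasOrder φ c k) = 1 := by
    obtain ⟨u, v, huv⟩ := List.append_of_mem (mem_iterWord_mul φ hbp (n + 1))
    have hother : (u ++ v).countP (fun c => HasOrder φ c k) = 0 :=
      List.countP_eq_zero.2 fun c hc => by
        simpa using hb.not_hasOrder_of_iterWord_eq hφ (by nlinarith) huv hc
    rw [List.countP_append] at hother
    rw [huv, List.countP_append, List.countP_cons]
    simp only [hb, decide_true, if_true]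
    omega
  have h1 := hmono n.zero_le
  have h2 := hmono (show n ≤ p * (n + 1) by nlinarith)
  simp only [hzero, hlast] at h1 h2
  omega

end Words

open Classical in
theorem List.existsUnique_get_of_countP_eq_one {α : Type*} {P : α → Prop} {l : List α}
    (h : l.countP P = 1) : ∃! i : Fin l.length, P (l.get i) := by
  induction l with
  | nil => simp at h
  | cons a l ih =>
    rw [List.countP_cons] at h
    by_cases ha : P a
    · simp only [ha, decide_true, if_true, Nat.add_eq_right, List.countP_eq_zero] at h
      refine ⟨⟨0, by simp⟩, ha, fun i hi => ?_⟩
      induction i using Fin.cases with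
      | zero => rfl
      | succ i => exact absurd (by simpa using hi) (by simpa using h _ (l.get_mem i))
    · simp [ha] at h
      obtain ⟨i, hi, huniq⟩ := ih h
      refine ⟨i.succ, hi, fun j hj => ?_⟩
      induction j using Fin.cases with
      | zero => exact absurd hj ha
      | succ j => exact congrArg Fin.succ (huniq j hj)

/-- If `b` has finite order `k`, then `φ(b)` contains a letter of order `k`;
moreover either `b` never occurs in `φ^n(b)` for `n ≥ 1` (preperiodic), or for
every `n` the word `φ^n(b)` contains exactly one occurrence of a letter of
order `k`, this letter `c_n` satisfies `c_0 = b`, and the sequence `(c_n)` is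
periodic (periodic letter). -/
theorem stmt6 {A : Type*} [Fintype A] (φ : A → List A)
    (hφ : ∀ b : A, φ b ≠ []) (b : A) (k : ℕ) (hb : HasOrder φ b k) :
    (∃ c ∈ φ b, HasOrder φ c k) ∧
    ((∀ n : ℕ, 1 ≤ n → b ∉ iterWord φ n [b]) ∨
      (∃ c : ℕ → A, c 0 = b ∧
        (∀ n : ℕ, ∃! i : Fin (iterWord φ n [b]).length,
            HasOrder φ ((iterWord φ n [b]).get i) k) ∧
        (∀ (n : ℕ) (i : Fin (iterWord φ n [b]).length),
            HasOrder φ ((iterWord φ n [b]).get i) k →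
            (iterWord φ n [b]).get i = c n) ∧
        (∃ d : ℕ, 1 ≤ d ∧ ∀ n : ℕ, c (n + d) = c n))) := by
  refine ⟨hb.exists_mem hφ, or_iff_not_imp_left.2 fun hrec => ?_⟩
  push Not at hrec
  obtain ⟨p, hp, hbp⟩ := hrec
  have huniq : ∀ n, ∃! i : Fin (iterWord φ n [b]).length,
      HasOrder φ ((iterWord φ n [b]).get i) k := fun n =>
    List.existsUnique_get_of_countP_eq_one (hb.countP_iterWord hφ hp hbp n)
  choose i hi hiuniq using huniq
  have heq : ∀ n, ∀ x ∈ iterWord φ n [b], HasOrder φ x k →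
      x = (iterWord φ n [b]).get (i n) := by
    intro n x hx hxk
    obtain ⟨j, rfl⟩ := List.get_of_mem hx
    rw [hiuniq n j hxk]
  refine ⟨fun n => (iterWord φ n [b]).get (i n), ?_, fun n => ⟨i n, hi n, hiuniq n⟩,
    fun n j hj => heq n _ (List.get_mem _ j) hj, p, hp, fun n => ?_⟩
  · exact (heq 0 b (by simp [iterWord]) hb).symm
  · exact (heq (n + p) _ (mem_iterWord_trans φ hbp (List.get_mem _ (i n))) (hi n)).symm
end

section
/- Let w be a nonempty finite word and suppose λ is the minimal complete period of the doubled word ww. If |w| ≥ 2|λ|, then |λ| divides |w|, w = λ^(|w|/|λ|), and λ is the minimal complete period of w. -/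
/-- `γ` is weakly `p`-periodic: `γ_i = γ_{i+p}` for all `0 ≤ i < |γ| − p`. -/
def WeaklyPeriodic {A : Type*} (γ : List A) (p : ℕ) : Prop :=
  ∀ i : ℕ, i + p < γ.length → γ[i]? = γ[i + p]?

/-- The word `lam` repeated `n` times. -/
def repWord {A : Type*} : ℕ → List A → List A
  | 0, _ => []
  | n + 1, lam => lam ++ repWord n lam

/-- `γ` is completely `lam`-periodic: `γ` is `lam` repeated an integer number
of times. -/
def CompletelyPeriodic {A : Type*} (γ lam : List A) : Prop :=
  ∃ m : ℕ, γ = repWord m lam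

/-- `lam` is the minimal complete period of `γ`. -/
def MinimalCompletePeriod {A : Type*} (γ lam : List A) : Prop :=
  1 ≤ lam.length ∧ 2 * lam.length ≤ γ.length ∧ CompletelyPeriodic γ lam ∧
    ∀ p : ℕ, 1 ≤ p → p < lam.length → ¬ WeaklyPeriodic γ p

theorem length_repWord {A : Type*} (m : ℕ) (l : List A) :
    (repWord m l).length = m * l.length := by
  induction m with
  | zero => simp [repWord]
  | succ m ih => simp [repWord, ih, Nat.succ_mul, Nat.add_comm]

theorem repWord_add {A : Type*} (a b : ℕ) (l : List A) :
    repWord (a + b) l = repWord a l ++ repWord b l := by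
  induction a with
  | zero => simp [repWord]
  | succ a ih => simp [Nat.succ_add, repWord, ih]

theorem getElem?_repWord {A : Type*} {m i : ℕ} {l : List A} (hi : i < m * l.length) :
    (repWord m l)[i]? = l[i % l.length]? := by
  induction m generalizing i with
  | zero => simp at hi
  | succ m ih =>
    rw [Nat.succ_mul] at hi
    rw [repWord]
    rcases lt_or_ge i l.length with h | h
    · rw [List.getElem?_append_left h, Nat.mod_eq_of_lt h]
    · rw [List.getElem?_append_right h, ih (by omega), ← Nat.mod_eq_sub_mod h]

/-- A power of `l` is weakly `p`-periodic as soon as `l` is invariant under rotation by `p`. -/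
theorem weaklyPeriodic_repWord {A : Type*} {m p : ℕ} {l : List A}
    (h : ∀ i < l.length, l[i]? = l[(i + p) % l.length]?) :
    WeaklyPeriodic (repWord m l) p := by
  intro i hi
  rw [length_repWord] at hi
  have hl : 0 < l.length := Nat.pos_of_ne_zero fun h0 => by simp [h0] at hi
  rw [getElem?_repWord (by omega), getElem?_repWord hi, h _ (Nat.mod_lt i hl), Nat.mod_add_mod]

/-- If `lam` is the minimal complete period of `w·w` and `|w| ≥ 2|lam|`, then
`|lam|` divides `|w|`, `w = lam^(|w|/|lam|)`, and `lam` is the minimal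
complete period of `w`. -/
theorem stmt12 {A : Type*} (w lam : List A) (hw : w ≠ [])
    (hlam : MinimalCompletePeriod (w ++ w) lam)
    (hlen : 2 * lam.length ≤ w.length) :
    lam.length ∣ w.length ∧
    w = repWord (w.length / lam.length) lam ∧
    MinimalCompletePeriod w lam := by
  obtain ⟨hpos, -, ⟨m, hm⟩, hmin⟩ := hlam
  have hlen2 : w.length + w.length = m * lam.length := by
    rw [← length_repWord, ← hm, List.length_append]
  have hrep : ∃ k, w = repWord k lam := by
    rcases Nat.even_or_odd' m with ⟨k, rfl | rfl⟩
    · rw [two_mul, repWord_add] at hm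
      exact ⟨k, (List.append_inj hm (by rw [length_repWord]; linarith)).1⟩
    · -- Here `w` ends in the middle of a copy of `lam`, so `lam` is itself a square.
      exfalso
      obtain ⟨h, hh⟩ : ∃ h, lam.length = 2 * h := by
        have : Even ((2 * k + 1) * lam.length) := ⟨w.length, hlen2.symm⟩
        rw [Nat.even_mul] at this
        exact (this.resolve_left (by simp)).two_dvd
      have hwlen : w.length = h + lam.length * k := by rw [hh] at hlen2 ⊢; linarith
      refine hmin h (by omega) (by omega) (hm ▸ weaklyPeriodic_repWord fun i hi => ?_)
      have hfirst : (w ++ w)[i]? = (w ++ w)[i + w.length]? := by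
        rw [List.getElem?_append_left (by omega), List.getElem?_append_right (by omega),
          Nat.add_sub_cancel]
      rw [hm, getElem?_repWord (by omega), getElem?_repWord (by omega), Nat.mod_eq_of_lt hi,
        hwlen, ← Nat.add_assoc, Nat.add_mul_mod_self_left] at hfirst
      exact hfirst
  obtain ⟨k, hk⟩ := hrep
  have hwlen : w.length = k * lam.length := by rw [hk, length_repWord]
  refine ⟨⟨k, by rw [hwlen, Nat.mul_comm]⟩, ?_, hpos, hlen, ⟨k, hk⟩, fun p hp hpl hper => ?_⟩
  · rw [hwlen, Nat.mul_div_cancel _ hpos]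
    exact hk
  · refine hmin p hp hpl (hm ▸ weaklyPeriodic_repWord fun i hi => ?_)
    have hshift := hper i (by omega)
    rw [hk, getElem?_repWord (by omega), getElem?_repWord (by omega),
      Nat.mod_eq_of_lt hi] at hshift
    exact hshift
end

section
/- Let Σ be a finite alphabet, φ : Σ* → Σ* a nonerasing morphism, and a ∈ Σ a letter of finite order K such that φ(a) = aγ for some nonempty γ ∈ Σ* (so necessarily K ≥ 2). Let α = φ^∞(a). Then: the letter a occurs in α only at position 0; every letter occurring in α at a position ≥ 1 has finite order < K; and α contains infinitely many occurrences of letters of order K − 1. -/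
open Asymptotics Filter

namespace MorphicGrowth

/-- `f` has exact polynomial growth of degree `j`, with one multiplicative constant. -/
def HasDegree (f : ℕ → ℕ) (j : ℕ) : Prop :=
  ∃ C : ℕ, ∀ n, (n + 1) ^ j ≤ C * f n ∧ f n ≤ C * (n + 1) ^ j

/-- `f` is bounded by a polynomial. -/
def PolyBounded (f : ℕ → ℕ) : Prop :=
  ∃ C d : ℕ, ∀ n, f n ≤ C * (n + 1) ^ d

theorem PolyBounded.of_le_shift {f g : ℕ → ℕ} (hg : PolyBounded g) (m : ℕ)
    (h : ∀ n, f n ≤ g (n + m)) : PolyBounded f := by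
  obtain ⟨C, d, hC⟩ := hg
  refine ⟨C * (m + 1) ^ d, d, fun n => (h n).trans ((hC _).trans ?_)⟩
  rw [mul_assoc, ← mul_pow]
  gcongr
  nlinarith [Nat.zero_le (m * n)]

theorem HasDegree.le_of_le_shift {f g : ℕ → ℕ} {i j : ℕ} (hf : HasDegree f i)
    (hg : HasDegree g j) (m : ℕ) (h : ∀ n, f n ≤ g (n + m)) : i ≤ j := by
  obtain ⟨C, hC⟩ := hf
  obtain ⟨D, hD⟩ := hg
  by_contra! hij
  set M := C * (D * (m + 1) ^ j) with hM
  have key : ∀ n : ℕ, n + 1 ≤ M := by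
    intro n
    have h1 : (n + 1) ^ (j + 1) ≤ M * (n + 1) ^ j := calc
      (n + 1) ^ (j + 1) ≤ (n + 1) ^ i := Nat.pow_le_pow_right (by omega) hij
      _ ≤ C * f n := (hC n).1
      _ ≤ C * (D * (n + m + 1) ^ j) := by
        gcongr
        exact (h n).trans (hD _).2
      _ ≤ C * (D * ((m + 1) * (n + 1)) ^ j) := by
        gcongr
        nlinarith [Nat.zero_le (m * n)]
      _ = M * (n + 1) ^ j := by rw [hM, mul_pow]; ring
    rw [pow_succ, mul_comm] at h1
    exact Nat.le_of_mul_le_mul_right h1 (by positivity)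
  have := key M
  omega

theorem HasDegree.add_of_le {f g : ℕ → ℕ} {i j : ℕ} (hf : HasDegree f i)
    (hg : HasDegree g j) (hij : i ≤ j) : HasDegree (fun n => f n + g n) j := by
  obtain ⟨C, hC⟩ := hf
  obtain ⟨D, hD⟩ := hg
  refine ⟨C + D, fun n => ⟨?_, ?_⟩⟩
  · calc (n + 1) ^ j ≤ D * g n := (hD n).1
      _ ≤ (C + D) * (f n + g n) := by gcongr <;> omega
  · have : (n + 1) ^ i ≤ (n + 1) ^ j := Nat.pow_le_pow_right (by omega) hij
    have h1 := (hC n).2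
    have h2 := (hD n).2
    have h3 := Nat.mul_le_mul_left C this
    rw [add_mul]
    dsimp only
    omega

theorem HasDegree.of_shift_one {f g : ℕ → ℕ} {j : ℕ} (hg : HasDegree g j) (hmono : Monotone f)
    (hpos : 0 < f 0) (h : ∀ n, f (n + 1) = g n) : HasDegree f j := by
  obtain ⟨C, hC⟩ := hg
  refine ⟨2 ^ j * C + 1, fun n => ⟨?_, ?_⟩⟩
  · cases n with
    | zero => simp only [zero_add, one_pow]; exact Nat.mul_pos (by omega) hpos
    | succ n =>
      calc (n + 1 + 1) ^ j ≤ (2 * (n + 1)) ^ j := by gcongr; omega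
        _ = 2 ^ j * (n + 1) ^ j := mul_pow _ _ _
        _ ≤ 2 ^ j * (C * g n) := by gcongr; exact (hC n).1
        _ = 2 ^ j * C * f (n + 1) := by rw [h]; ring
        _ ≤ _ := by gcongr; omega
  · calc f n ≤ f (n + 1) := hmono (by omega)
      _ ≤ C * (n + 1) ^ j := by rw [h]; exact (hC n).2
      _ ≤ _ := by
        gcongr
        nlinarith [Nat.one_le_two_pow (n := j)]

theorem exists_add_pow_succ_le (p j : ℕ) :
    ∃ M : ℕ, ∀ x : ℕ, 1 ≤ x → (x + p) ^ (j + 1) ≤ x ^ (j + 1) + M * x ^ j := by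
  induction j with
  | zero => exact ⟨p, fun x _ => by simp⟩
  | succ j ih =>
    obtain ⟨M, hM⟩ := ih
    refine ⟨M + p + M * p, fun x hx => ?_⟩
    have h1 : x ^ j ≤ x ^ (j + 1) := Nat.pow_le_pow_right hx (by omega)
    calc (x + p) ^ (j + 1 + 1) = (x + p) ^ (j + 1) * (x + p) := pow_succ _ _
      _ ≤ (x ^ (j + 1) + M * x ^ j) * (x + p) := by gcongr; exact hM x hx
      _ = x ^ (j + 1 + 1) + (M + p) * x ^ (j + 1) + M * p * x ^ j := by ring
      _ ≤ x ^ (j + 1 + 1) + (M + p) * x ^ (j + 1) + M * p * x ^ (j + 1) := by gcongr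
      _ = _ := by ring

theorem HasDegree.of_recurrence {f g : ℕ → ℕ} {j p : ℕ} (hg : HasDegree g j) (hp : 1 ≤ p)
    (hmono : Monotone f) (hpos : 0 < f 0) (h : ∀ n, f (n + p) = f n + g n) :
    HasDegree f (j + 1) := by
  obtain ⟨C, hC⟩ := hg
  obtain ⟨M, hM⟩ := exists_add_pow_succ_le p j
  have upper : ∀ n, f n ≤ (C + f p) * (n + 1) ^ (j + 1) := by
    intro n
    induction n using Nat.strong_induction_on with
    | _ n ih =>
      rcases lt_or_ge n p with hn | hn
      · calc f n ≤ f p := hmono hn.le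
          _ ≤ (C + f p) * 1 := by omega
          _ ≤ _ := by gcongr; exact Nat.one_le_pow _ _ (by omega)
      · obtain ⟨m, rfl⟩ := Nat.exists_eq_add_of_le' hn
        rw [h]
        calc f m + g m ≤ (C + f p) * (m + 1) ^ (j + 1) + (C + f p) * (m + 1) ^ j := by
              gcongr
              · exact ih m (by omega)
              · exact (hC m).2.trans (Nat.mul_le_mul_right _ (by omega))
          _ = (C + f p) * ((m + 1) ^ j * (m + 2)) := by ring
          _ ≤ (C + f p) * ((m + p + 1) ^ j * (m + p + 1)) :=
            Nat.mul_le_mul_left _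
              (Nat.mul_le_mul (Nat.pow_le_pow_left (by omega) j) (by omega))
          _ = _ := by rw [pow_succ]
  have lower : ∀ n, (n + 1) ^ (j + 1) ≤ (M * C + p ^ (j + 1)) * f n := by
    intro n
    induction n using Nat.strong_induction_on with
    | _ n ih =>
      rcases lt_or_ge n p with hn | hn
      · have h1 : 1 ≤ f n := hpos.trans_le (hmono (Nat.zero_le n))
        calc (n + 1) ^ (j + 1) ≤ p ^ (j + 1) * 1 := by rw [mul_one]; gcongr; omega
          _ ≤ _ := by gcongr; omega
      · obtain ⟨m, rfl⟩ := Nat.exists_eq_add_of_le' hn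
        have h1 := hM (m + 1) (by omega)
        rw [h]
        calc (m + p + 1) ^ (j + 1) = (m + 1 + p) ^ (j + 1) := by ring
          _ ≤ (m + 1) ^ (j + 1) + M * (m + 1) ^ j := h1
          _ ≤ (M * C + p ^ (j + 1)) * f m + M * (C * g m) := by
            gcongr
            · exact ih m (by omega)
            · exact (hC m).1
          _ ≤ (M * C + p ^ (j + 1)) * f m + (M * C + p ^ (j + 1)) * g m := by
            rw [← mul_assoc]; gcongr; omega
          _ = _ := by ring
  refine ⟨(C + f p) + (M * C + p ^ (j + 1)), fun n => ⟨(lower n).trans ?_, (upper n).trans ?_⟩⟩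
  · exact Nat.mul_le_mul_right _ (by omega)
  · exact Nat.mul_le_mul_right _ (by omega)

theorem hasDegree_zero_of_periodic {f : ℕ → ℕ} {p : ℕ} (hp : 1 ≤ p) (hmono : Monotone f)
    (hpos : 0 < f 0) (h : ∀ n, f (n + p) = f n) : HasDegree f 0 := by
  have hmul : ∀ k, f (k * p) = f 0 := by
    intro k
    induction k with
    | zero => simp
    | succ k ih => rw [Nat.succ_mul, h, ih]
  have hconst : ∀ n, f n = f 0 := fun n =>
    le_antisymm ((hmono (Nat.le_mul_of_pos_right n hp)).trans (hmul n).le)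
      (hmono (Nat.zero_le n))
  refine ⟨f 0, fun n => ?_⟩
  rw [hconst n]
  simp only [pow_zero, mul_one, le_refl, and_true]
  exact Nat.mul_pos hpos hpos

theorem not_polyBounded_of_doubling {f : ℕ → ℕ} {q : ℕ} (hpos : 0 < f 0)
    (h : ∀ n, 2 * f n ≤ f (n + q)) : ¬ PolyBounded f := by
  rintro ⟨C, d, hC⟩
  have hpow : ∀ k, 2 ^ k ≤ f (k * q) := by
    intro k
    induction k with
    | zero => simpa using Nat.succ_le_of_lt hpos
    | succ k ih =>
      rw [Nat.succ_mul, pow_succ]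
      have := h (k * q)
      omega
  have hbound : ∀ k : ℕ, 1 ≤ k → 2 ^ k ≤ C * (q + 1) ^ d * k ^ d := by
    intro k hk
    calc 2 ^ k ≤ f (k * q) := hpow k
      _ ≤ C * (k * q + 1) ^ d := hC _
      _ ≤ C * ((q + 1) * k) ^ d := by gcongr; nlinarith
      _ = _ := by rw [mul_pow, mul_assoc]
  have ho : (fun n : ℕ => (n : ℝ) ^ d) =o[atTop] fun n => (2 : ℝ) ^ n :=
    isLittleO_pow_const_const_pow_of_one_lt d (by norm_num)
  have hO : (fun n : ℕ => (2 : ℝ) ^ n) =O[atTop] fun n => (n : ℝ) ^ d := by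
    refine IsBigO.of_bound ((C * (q + 1) ^ d : ℕ) : ℝ) ?_
    filter_upwards [eventually_ge_atTop 1] with k hk
    have := hbound k hk
    rw [Real.norm_of_nonneg (by positivity), Real.norm_of_nonneg (by positivity)]
    exact_mod_cast this
  have := hO.trans_isLittleO ho
  exact isLittleO_irrefl (Frequently.of_forall fun n => by positivity) this

section Words

variable {A : Type*} (φ : A → List A)

theorem substWord_append (u v : List A) :
    substWord φ (u ++ v) = substWord φ u ++ substWord φ v := by
  induction u with
  | nil => rfl
  | cons b u ih => simp [substWord, ih]

theorem iterWord_append (n : ℕ) (u v : List A) :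
    iterWord φ n (u ++ v) = iterWord φ n u ++ iterWord φ n v := by
  induction n generalizing u v with
  | zero => rfl
  | succ n ih =>
    simp only [iterWord, Function.iterate_succ_apply, substWord_append] at ih ⊢
    exact ih _ _

theorem iterWord_nil (n : ℕ) : iterWord φ n [] = [] := by
  induction n with
  | zero => rfl
  | succ n ih => rw [iterWord, Function.iterate_succ_apply]; exact ih

theorem iterWord_add (n m : ℕ) (w : List A) :
    iterWord φ (n + m) w = iterWord φ n (iterWord φ m w) :=
  Function.iterate_add_apply _ _ _ _

theorem iterWord_one_singleton (b : A) : iterWord φ 1 [b] = φ b := by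
  simp [iterWord, substWord]

theorem mem_iterWord_trans {m n : ℕ} {w : List A} {c d : A} (hc : c ∈ iterWord φ m w)
    (hd : d ∈ iterWord φ n [c]) : d ∈ iterWord φ (n + m) w := by
  obtain ⟨u, v, huv⟩ := List.append_of_mem hc
  rw [iterWord_add, huv, ← List.singleton_append, iterWord_append, iterWord_append]
  simp [hd]

/-- The length of the `n`-th iterate of the word `w`. -/
def wordLength (w : List A) (n : ℕ) : ℕ := (iterWord φ n w).length

theorem wordLength_append (u v : List A) (n : ℕ) :
    wordLength φ (u ++ v) n = wordLength φ u n + wordLength φ v n := by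
  simp [wordLength, iterWord_append]

theorem wordLength_cons (b : A) (v : List A) (n : ℕ) :
    wordLength φ (b :: v) n = wordLength φ [b] n + wordLength φ v n :=
  wordLength_append φ [b] v n

theorem wordLength_iterWord (w : List A) (m n : ℕ) :
    wordLength φ (iterWord φ m w) n = wordLength φ w (n + m) := by
  rw [wordLength, wordLength, iterWord_add]

theorem wordLength_le_of_mem {w : List A} {c : A} (hc : c ∈ w) (n : ℕ) :
    wordLength φ [c] n ≤ wordLength φ w n := by
  obtain ⟨u, v, rfl⟩ := List.append_of_mem hc
  rw [wordLength_append, wordLength_cons φ c v]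
  omega

theorem wordLength_le_of_mem_iterWord {w : List A} {c : A} {m : ℕ}
    (hc : c ∈ iterWord φ m w) (n : ℕ) : wordLength φ [c] n ≤ wordLength φ w (n + m) := by
  rw [← wordLength_iterWord]
  exact wordLength_le_of_mem φ hc n

theorem length_le_length_substWord (hφ : ∀ b, φ b ≠ []) (w : List A) :
    w.length ≤ (substWord φ w).length := by
  induction w with
  | nil => simp [substWord]
  | cons b w ih =>
    have := List.length_pos_iff.2 (hφ b)
    simp only [substWord, List.length_append, List.length_cons]
    omega

theorem wordLength_monotone (hφ : ∀ b, φ b ≠ []) (w : List A) :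
    Monotone (wordLength φ w) := by
  refine monotone_nat_of_le_succ fun n => ?_
  simp only [wordLength, iterWord, Function.iterate_succ_apply']
  exact length_le_length_substWord φ hφ _

theorem wordLength_zero (w : List A) : wordLength φ w 0 = w.length := rfl

theorem exists_hasDegree_of_letters {w : List A} (hw : w ≠ [])
    (h : ∀ b ∈ w, ∃ j, HasDegree (wordLength φ [b]) j) :
    ∃ j, HasDegree (wordLength φ w) j ∧ ∃ b ∈ w, HasDegree (wordLength φ [b]) j := by
  induction w with
  | nil => exact absurd rfl hw
  | cons b w ih =>
    obtain ⟨i, hi⟩ := h b (by simp)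
    rcases eq_or_ne w [] with rfl | hne
    · exact ⟨i, hi, b, by simp, hi⟩
    obtain ⟨j, hj, c, hc, hcj⟩ := ih hne fun c hc => h c (by simp [hc])
    rcases le_total i j with hij | hij
    · refine ⟨j, ?_, c, by simp [hc], hcj⟩
      rw [funext (wordLength_cons φ b w)]
      exact hi.add_of_le hj hij
    · refine ⟨i, ?_, b, by simp, hi⟩
      rw [funext (wordLength_cons φ b w)]
      simpa only [add_comm] using hj.add_of_le hi hij

/-- The letters occurring in some iterate of `b`. -/
def reachable (b : A) : Set A := {c | ∃ m, c ∈ iterWord φ m [b]}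

theorem ncard_reachable_lt [Finite A] {b c : A} (hc : c ∈ reachable φ b)
    (hb : b ∉ reachable φ c) : (reachable φ c).ncard < (reachable φ b).ncard := by
  obtain ⟨m, hm⟩ := hc
  refine Set.ncard_lt_ncard (Set.ssubset_iff_exists.2 ⟨?_, b, ⟨0, ?_⟩, hb⟩) (Set.toFinite _)
  · rintro d ⟨n, hn⟩
    exact ⟨n + m, mem_iterWord_trans φ hm hn⟩
  · simp [iterWord]

/-- A letter whose growth is polynomially bounded has an exact degree of growth. -/
theorem exists_hasDegree [Finite A] (hφ : ∀ b, φ b ≠ []) (b : A)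
    (hb : PolyBounded (wordLength φ [b])) : ∃ j, HasDegree (wordLength φ [b]) j := by
  induction hr : (reachable φ b).ncard using Nat.strong_induction_on generalizing b with
  | _ r ih =>
  subst hr
  have hmono := wordLength_monotone φ hφ [b]
  have hpos : 0 < wordLength φ [b] 0 := by simp [wordLength_zero]
  have step : ∀ (p : ℕ) (c : A), c ∈ iterWord φ p [b] → b ∉ reachable φ c →
      ∃ j, HasDegree (wordLength φ [c]) j := fun p c hc hcb =>
    ih _ (ncard_reachable_lt φ ⟨p, hc⟩ hcb) c
      (hb.of_le_shift p (wordLength_le_of_mem_iterWord φ hc)) rfl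
  by_cases hcyc : ∃ p, 1 ≤ p ∧ b ∈ iterWord φ p [b]
  · obtain ⟨p, hp, hbp⟩ := hcyc
    obtain ⟨u, v, huv⟩ := List.append_of_mem hbp
    have hrec : ∀ n, wordLength φ [b] (n + p) =
        wordLength φ [b] n + wordLength φ (u ++ v) n := by
      intro n
      rw [← wordLength_iterWord, huv, wordLength_append, wordLength_cons, wordLength_append]
      omega
    have hletters : ∀ c ∈ u ++ v, ∃ j, HasDegree (wordLength φ [c]) j := by
      intro c hc
      refine step p c ?_ ?_
      · rw [huv]
        simp only [List.mem_append, List.mem_cons] at hc ⊢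
        tauto
      · rintro ⟨m, hm⟩
        refine not_polyBounded_of_doubling (q := m + p) hpos (fun n => ?_) hb
        have h1 := hrec (n + m)
        have h2 := wordLength_le_of_mem φ hc (n + m)
        have h3 := wordLength_le_of_mem_iterWord φ hm n
        have h4 : wordLength φ [b] n ≤ wordLength φ [b] (n + m) := hmono (by omega)
        rw [← add_assoc]
        omega
    by_cases hnil : u ++ v = []
    · refine ⟨0, hasDegree_zero_of_periodic hp hmono hpos fun n => ?_⟩
      rw [hrec, hnil]
      simp [wordLength, iterWord_nil]
    · obtain ⟨j, hj, -⟩ := exists_hasDegree_of_letters φ hnil hletters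
      exact ⟨j + 1, hj.of_recurrence hp hmono hpos hrec⟩
  · have hone := iterWord_one_singleton φ b
    obtain ⟨j, hj, -⟩ := exists_hasDegree_of_letters φ (hφ b) fun c hc =>
      step 1 c (hone ▸ hc) fun ⟨m, hm⟩ =>
        hcyc ⟨m + 1, by omega, mem_iterWord_trans φ (hone ▸ hc) hm⟩
    refine ⟨j, hj.of_shift_one hmono hpos fun n => ?_⟩
    rw [← hone, wordLength_iterWord]

theorem HasDegree.isTheta {f : ℕ → ℕ} {j : ℕ} (hf : HasDegree f j) :
    (fun n => (f n : ℝ)) =Θ[atTop] fun n => (n : ℝ) ^ j := by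
  obtain ⟨C, hC⟩ := hf
  constructor
  · refine IsBigO.of_bound ((C * 2 ^ j : ℕ) : ℝ) ?_
    filter_upwards [eventually_ge_atTop 1] with n hn
    have : f n ≤ C * 2 ^ j * n ^ j := by
      refine (hC n).2.trans ?_
      rw [mul_assoc, ← mul_pow]
      gcongr
      omega
    rw [Real.norm_of_nonneg (by positivity), Real.norm_of_nonneg (by positivity)]
    exact_mod_cast this
  · refine IsBigO.of_bound (C : ℝ) (Eventually.of_forall fun n => ?_)
    have : n ^ j ≤ C * f n := le_trans (by gcongr; omega) (hC n).1
    rw [Real.norm_of_nonneg (by positivity), Real.norm_of_nonneg (by positivity)]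
    exact_mod_cast this

theorem HasDegree.hasOrder {b : A} {j : ℕ} (h : HasDegree (wordLength φ [b]) j) :
    HasOrder φ b (j + 1) :=
  ⟨by omega, h.isTheta⟩

theorem le_of_isTheta_pow {i j : ℕ}
    (h : (fun n : ℕ => (n : ℝ) ^ i) =Θ[atTop] fun n : ℕ => (n : ℝ) ^ j) : i ≤ j := by
  by_contra! hij
  have ho : (fun n : ℕ => (n : ℝ) ^ j) =o[atTop] fun n : ℕ => (n : ℝ) ^ i :=
    (isLittleO_pow_pow_atTop_of_lt (𝕜 := ℝ) hij).comp_tendsto tendsto_natCast_atTop_atTop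
  refine isLittleO_irrefl ?_ (h.1.trans_isLittleO ho)
  refine Eventually.frequently ?_
  filter_upwards [eventually_ge_atTop 1] with n hn
  positivity

theorem polyBounded_of_hasOrder (hφ : ∀ b, φ b ≠ []) {b : A} {k : ℕ} (h : HasOrder φ b k) :
    PolyBounded (wordLength φ [b]) := by
  obtain ⟨C, -, hC⟩ := bound_of_isBigO_nat_atTop h.2.1
  refine ⟨⌈C⌉₊, k - 1, fun n => ?_⟩
  have h1 := hC (x := n + 1) (by positivity)
  rw [Real.norm_of_nonneg (by positivity), Real.norm_of_nonneg (by positivity)] at h1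
  have h2 : (wordLength φ [b] (n + 1) : ℝ) ≤ ⌈C⌉₊ * ((n + 1 : ℕ) : ℝ) ^ (k - 1) :=
    h1.trans (by gcongr; exact Nat.le_ceil C)
  exact (wordLength_monotone φ hφ [b] (Nat.le_succ n)).trans (by exact_mod_cast h2)

theorem iterWord_succ_of_prolongable {a : A} {γ : List A} (ha : φ a = a :: γ)
    (n : ℕ) :
    iterWord φ (n + 1) [a] = iterWord φ n [a] ++ iterWord φ n γ := by
  rw [iterWord_add, iterWord_one_singleton, ha, ← List.singleton_append, iterWord_append]

theorem exists_iterWord_eq_cons {a : A} {γ : List A} (ha : φ a = a :: γ)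
    (n : ℕ) :
    ∃ t, iterWord φ n [a] = a :: t ∧ ∀ c ∈ t, ∃ m, c ∈ iterWord φ m γ := by
  induction n with
  | zero => exact ⟨[], rfl, by simp⟩
  | succ n ih =>
    obtain ⟨t, ht, h⟩ := ih
    refine ⟨t ++ iterWord φ n γ, by rw [iterWord_succ_of_prolongable φ ha, ht]; rfl, ?_⟩
    intro c hc
    rcases List.mem_append.1 hc with hc | hc
    · exact h c hc
    · exact ⟨n, hc⟩

theorem lt_wordLength_of_prolongable {a : A} {γ : List A} (ha : φ a = a :: γ)
    (hφ : ∀ b, φ b ≠ []) (hγ : γ ≠ []) (n : ℕ) :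
    n < wordLength φ [a] n := by
  induction n with
  | zero => simp [wordLength_zero]
  | succ n ih =>
    have h1 : 1 ≤ wordLength φ γ n :=
      (List.length_pos_iff.2 hγ).trans_le (wordLength_monotone φ hφ γ (Nat.zero_le n))
    have h2 : wordLength φ [a] (n + 1) = wordLength φ [a] n + wordLength φ γ n := by
      simp [wordLength, iterWord_succ_of_prolongable φ ha]
    omega

end Words

end MorphicGrowth

open MorphicGrowth in
/-- If `a` has finite order `K` and `φ(a) = aγ` with `γ` nonempty, then
`K ≥ 2`; the letter `a` occurs in `α = φ^∞(a)` only at position `0`; every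
letter occurring in `α` at a position `≥ 1` has finite order `< K`; and `α`
contains infinitely many occurrences of letters of order `K − 1`. -/
theorem stmt17 {A : Type*} [Fintype A]
    (φ : A → List A) (hφ : ∀ b : A, φ b ≠ [])
    (a : A) (K : ℕ) (haK : HasOrder φ a K)
    (γ : List A) (hγ : γ ≠ []) (ha : φ a = a :: γ)
    (α : ℕ → A)
    (hα : ∀ (n i : ℕ) (h : i < (iterWord φ n [a]).length),
      (iterWord φ n [a]).get ⟨i, h⟩ = α i) :
    2 ≤ K ∧
    α 0 = a ∧ (∀ i : ℕ, α i = a → i = 0) ∧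
    (∀ i : ℕ, 1 ≤ i → ∃ k : ℕ, k < K ∧ HasOrder φ (α i) k) ∧
    (∀ N : ℕ, ∃ i : ℕ, N ≤ i ∧ HasOrder φ (α i) (K - 1)) := by
  have hpoly := polyBounded_of_hasOrder φ hφ haK
  have hrec : ∀ n, wordLength φ [a] (n + 1) = wordLength φ [a] n + wordLength φ γ n := by
    intro n
    simp [wordLength, iterWord_succ_of_prolongable φ ha]
  have hletter : ∀ m, ∀ c ∈ iterWord φ m γ, ∃ j, HasDegree (wordLength φ [c]) j := by
    intro m c hc
    refine exists_hasDegree φ hφ c (hpoly.of_le_shift (m + 1) fun n => ?_)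
    have h1 := wordLength_le_of_mem_iterWord φ hc n
    have h2 := hrec (n + m)
    rw [← add_assoc]
    omega
  obtain ⟨j, hj, -⟩ := exists_hasDegree_of_letters φ hγ (hletter 0)
  have haj : HasDegree (wordLength φ [a]) (j + 1) :=
    hj.of_recurrence le_rfl (wordLength_monotone φ hφ [a]) (by simp [wordLength_zero]) hrec
  have hKj : K = j + 2 := by
    have h1 := le_of_isTheta_pow (haK.2.symm.trans haj.isTheta)
    have h2 := le_of_isTheta_pow (haj.isTheta.symm.trans haK.2)
    have := haK.1
    omega
  have hle : ∀ m, ∀ c ∈ iterWord φ m γ, ∀ k, HasDegree (wordLength φ [c]) k → k ≤ j :=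
    fun m c hc k hk => hk.le_of_le_shift hj m (wordLength_le_of_mem_iterWord φ hc)
  have hpos : ∀ i, 1 ≤ i → ∃ m, α i ∈ iterWord φ m γ := by
    intro i hi
    have hlt := lt_wordLength_of_prolongable φ ha hφ hγ i
    obtain ⟨t, ht, hmem⟩ := exists_iterWord_eq_cons φ ha i
    apply hmem
    rw [← hα i i hlt]
    obtain ⟨i, rfl⟩ := Nat.exists_eq_add_of_le' hi
    simp only [ht, List.get_eq_getElem, List.getElem_cons_succ]
    exact List.getElem_mem _
  subst hKj
  refine ⟨by omega, ?_, ?_, ?_, ?_⟩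
  · exact (hα 0 0 (by simp [iterWord])).symm
  · intro i hi
    by_contra hne
    obtain ⟨m, hm⟩ := hpos i (by omega)
    have := hle m _ hm (j + 1) (hi ▸ haj)
    omega
  · intro i hi
    obtain ⟨m, hm⟩ := hpos i hi
    obtain ⟨k, hk⟩ := hletter m _ hm
    have := hle m _ hm k hk
    exact ⟨k + 1, by omega, hk.hasOrder φ⟩
  · intro N
    have hne : iterWord φ N γ ≠ [] :=
      List.length_pos_iff.1 ((List.length_pos_iff.2 hγ).trans_le
        (wordLength_monotone φ hφ γ (Nat.zero_le N)))
    obtain ⟨k, hk, c, hc, hck⟩ := exists_hasDegree_of_letters φ hne (hletter N)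
    have hkj : k = j := by
      refine le_antisymm (hle N c hc k hck) (hj.le_of_le_shift hk 0 fun n => ?_)
      rw [wordLength_iterWord]
      exact wordLength_monotone φ hφ γ (by omega)
    subst hkj
    obtain ⟨i, hi, hic⟩ := List.getElem_of_mem hc
    have hN := lt_wordLength_of_prolongable φ ha hφ hγ N
    have hlen : wordLength φ [a] N + i < (iterWord φ (N + 1) [a]).length := by
      rw [iterWord_succ_of_prolongable φ ha, List.length_append]
      exact Nat.add_lt_add_left hi _
    refine ⟨wordLength φ [a] N + i, by omega, ?_⟩
    have hval : α (wordLength φ [a] N + i) = c := by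
      rw [← hα (N + 1) _ hlen, ← hic]
      simp [iterWord_succ_of_prolongable φ ha, wordLength]
    rw [hval]
    exact hck.hasOrder φ
end
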